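/- In the two-dimensional Silver Dollar game with pushing (two coins on an unbounded board, a move slides one coin any number of squares to the left or upward, a coin slid off the board is removed from play, jumping over or onto the other coin is illegal, but a coin may be slid into the other coin and push it along in the same direction; the player unable to move loses), the set of P-positions is exactly {(w,x,y,z) : (w-1) ⊕ (x-1) ⊕ (y-1) ⊕ (z-1) = 0}, where (w,x) and (y,z) with w,x,y,z ≥ 1 are the board coordinates of the two coins and ⊕ denotes the bitwise XOR (nim-sum). -/

import Mathlib

mutual
  /-- P-position: the previous player (who just moved) can force a win;
      equivalently, every move leads to an N-position. -/
  inductive PPosition {α : Type} (Move : α → α → Prop) : α → Prop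
    | intro (p : α) (h : ∀ q, Move p q → NPosition Move q) : PPosition Move p
  /-- N-position: the player to move can force a win, i.e. some move leads to a P-position. -/
  inductive NPosition {α : Type} (Move : α → α → Prop) : α → Prop
    | intro (p q : α) (h : Move p q) (hq : PPosition Move q) : NPosition Move p
end

/-- A coin on the board at column `w`, row `x` (both `≥ 1` when on the board);
if either coordinate is `0` the coin has slid off the board and is removed (`none`). -/
def coin (w x : ℕ) : Option (ℕ × ℕ) := if w = 0 ∨ x = 0 then none else some (w, x)

/-- Effect on the other coin `c` when a coin at `(w, x)` slides left to column `t < w`: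
if `c` lies in the same row inside the path of motion, it is pushed along to column
`t - 1` (and slides off the board if `t - 1 = 0`); otherwise it is unaffected. -/
def pushX (w x t : ℕ) : Option (ℕ × ℕ) → Option (ℕ × ℕ)
  | none => none
  | some (y, z) => if z = x ∧ t ≤ y ∧ y < w then coin (t - 1) z else some (y, z)

/-- Effect on the other coin `c` when a coin at `(w, x)` slides up to row `t < x`. -/
def pushY (w x t : ℕ) : Option (ℕ × ℕ) → Option (ℕ × ℕ)
  | none => none
  | some (y, z) => if y = w ∧ t ≤ z ∧ z < x then coin y (t - 1) else some (y, z)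

/-- Moves of the two-dimensional Silver Dollar game with pushing: a move slides one of
the coins any number of squares to the left or upward; a coin slid off the board is
removed; jumping over or onto the other coin is impossible, since a coin encountered
in the path of motion is pushed along in the same direction (possibly off the board). -/
inductive PushMove :
    Option (ℕ × ℕ) × Option (ℕ × ℕ) → Option (ℕ × ℕ) × Option (ℕ × ℕ) → Prop
  | left₁ (w x t : ℕ) (c : Option (ℕ × ℕ)) (ht : t < w) :
      PushMove (some (w, x), c) (coin t x, pushX w x t c)
  | up₁ (w x t : ℕ) (c : Option (ℕ × ℕ)) (ht : t < x) :
      PushMove (some (w, x), c) (coin w t, pushY w x t c)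
  | left₂ (w x t : ℕ) (c : Option (ℕ × ℕ)) (ht : t < w) :
      PushMove (c, some (w, x)) (pushX w x t c, coin t x)
  | up₂ (w x t : ℕ) (c : Option (ℕ × ℕ)) (ht : t < x) :
      PushMove (c, some (w, x)) (pushY w x t c, coin w t)

theorem PPosition.not_nPosition {α : Type} {Move : α → α → Prop} {p : α}
    (hp : PPosition Move p) : ¬ NPosition Move p := by
  refine PPosition.rec (motive_1 := fun p _ => ¬ NPosition Move p)
    (motive_2 := fun p _ => ¬ PPosition Move p) ?_ ?_ hp
  · rintro p _ ih ⟨_, q, hpq, hq⟩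
    exact ih q hpq hq
  · rintro p q hpq _ ih ⟨_, h⟩
    exact ih (h q hpq)

@[simp] theorem coin_zero_left (x : ℕ) : coin 0 x = none := by simp [coin]

@[simp] theorem coin_zero_right (w : ℕ) : coin w 0 = none := by simp [coin]

@[simp] theorem coin_succ_succ (w x : ℕ) : coin (w + 1) (x + 1) = some (w + 1, x + 1) := by
  simp [coin]

theorem pPosition_none_none : PPosition PushMove (none, none) :=
  ⟨_, fun _ h => by cases h⟩

theorem nPosition_some_none (a b : ℕ) : NPosition PushMove (some (a + 1, b + 1), none) := by
  refine ⟨_, _, .left₁ (a + 1) (b + 1) 0 none (by omega), ?_⟩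
  simpa [pushX] using pPosition_none_none

theorem nPosition_none_some (a b : ℕ) : NPosition PushMove (none, some (a + 1, b + 1)) := by
  refine ⟨_, _, .left₂ (a + 1) (b + 1) 0 none (by omega), ?_⟩
  simpa [pushX] using pPosition_none_none

theorem pushX_eq_self {w x t y z : ℕ} (h : z = x → w ≤ y) :
    pushX w x t (some (y, z)) = some (y, z) := by
  simp only [pushX]
  exact if_neg fun h' => by have := h h'.1; omega

theorem pushY_eq_self {w x t y z : ℕ} (h : y = w → x ≤ z) :
    pushY w x t (some (y, z)) = some (y, z) := by
  simp only [pushY]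
  exact if_neg fun h' => by have := h h'.1; omega

/-- In a four-pile Nim position of nonzero nim-sum, some pile can be decreased so as to make
the nim-sum vanish. -/
theorem exists_lt_xor_eq_zero {a b c d : ℕ} (h : a ^^^ b ^^^ c ^^^ d ≠ 0) :
    (∃ t < a, t ^^^ b ^^^ c ^^^ d = 0) ∨ (∃ t < b, a ^^^ t ^^^ c ^^^ d = 0) ∨
      (∃ t < c, a ^^^ b ^^^ t ^^^ d = 0) ∨ ∃ t < d, a ^^^ b ^^^ c ^^^ t = 0 := by
  have h' : a ^^^ b ^^^ (c ^^^ d) ≠ 0 := by rwa [← Nat.xor_assoc]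
  rcases Nat.xor_trichotomy h' with h | h | h
  · refine .inl ⟨_, h, ?_⟩
    rw [Nat.xor_assoc _ c d, Nat.xor_assoc _ b, Nat.xor_self]
  · refine .inr (.inl ⟨_, h, ?_⟩)
    rw [Nat.xor_comm _ a]
    simp
  · rcases Nat.lt_xor_cases h with h | h
    · refine .inr (.inr (.inl ⟨_, h, ?_⟩))
      rw [← Nat.xor_assoc, Nat.xor_self, Nat.zero_xor, Nat.xor_self]
    · refine .inr (.inr (.inr ⟨_, h, ?_⟩))
      exact Nat.xor_self _

theorem pPosition_and_nPosition (n : ℕ) : ∀ a b c d : ℕ, a + b + c + d = n →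
    (a ^^^ b ^^^ c ^^^ d = 0 →
      PPosition PushMove (some (a + 1, b + 1), some (c + 1, d + 1))) ∧
    (a ^^^ b ^^^ c ^^^ d ≠ 0 →
      NPosition PushMove (some (a + 1, b + 1), some (c + 1, d + 1))) := by
  induction n using Nat.strong_induction_on with
  | _ n ih =>
  intro a b c d hn
  refine ⟨fun h0 => ?_, fun h0 => ?_⟩
  · have hrow : b = d → a = c := by
      rintro rfl
      simpa [Nat.xor_eq_zero_iff, Nat.xor_right_comm a b c] using h0
    have hcol : a = c → b = d := by
      rintro rfl
      simpa [Nat.xor_eq_zero_iff, Nat.xor_comm a b] using h0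
    refine ⟨_, fun q hq => ?_⟩
    cases hq with
    | left₁ _ _ t _ ht =>
      rw [pushX_eq_self (by omega)]
      rcases t with _ | t
      · simpa using nPosition_none_some c d
      rw [coin_succ_succ]
      refine (ih _ (by omega) t b c d rfl).2 fun h => ?_
      simp only [← h0, Nat.xor_left_inj] at h
      omega
    | up₁ _ _ t _ ht =>
      rw [pushY_eq_self (by omega)]
      rcases t with _ | t
      · simpa using nPosition_none_some c d
      rw [coin_succ_succ]
      refine (ih _ (by omega) a t c d rfl).2 fun h => ?_
      simp only [← h0, Nat.xor_left_inj, Nat.xor_right_inj] at h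
      omega
    | left₂ _ _ t _ ht =>
      rw [pushX_eq_self (by omega)]
      rcases t with _ | t
      · simpa using nPosition_some_none a b
      rw [coin_succ_succ]
      refine (ih _ (by omega) a b t d rfl).2 fun h => ?_
      simp only [← h0, Nat.xor_left_inj, Nat.xor_right_inj] at h
      omega
    | up₂ _ _ t _ ht =>
      rw [pushY_eq_self (by omega)]
      rcases t with _ | t
      · simpa using nPosition_some_none a b
      rw [coin_succ_succ]
      refine (ih _ (by omega) a b c t rfl).2 fun h => ?_
      simp only [← h0, Nat.xor_right_inj] at h
      omega
  · by_cases hrow : d = b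
    · subst hrow
      have hac : a ≠ c := by
        rintro rfl
        simp [Nat.xor_right_comm a d a] at h0
      rcases hac.lt_or_gt with hlt | hlt
      · refine ⟨_, _, .left₂ (c + 1) (d + 1) 0 _ (by omega), ?_⟩
        simpa [pushX, hlt] using pPosition_none_none
      · refine ⟨_, _, .left₁ (a + 1) (d + 1) 0 _ (by omega), ?_⟩
        simpa [pushX, hlt] using pPosition_none_none
    by_cases hcol : c = a
    · subst hcol
      rcases Ne.lt_or_gt hrow with hlt | hlt
      · refine ⟨_, _, .up₁ (c + 1) (b + 1) 0 _ (by omega), ?_⟩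
        simpa [pushY, hlt] using pPosition_none_none
      · refine ⟨_, _, .up₂ (c + 1) (d + 1) 0 _ (by omega), ?_⟩
        simpa [pushY, hlt] using pPosition_none_none
    rcases exists_lt_xor_eq_zero h0 with ⟨t, ht, h⟩ | ⟨t, ht, h⟩ | ⟨t, ht, h⟩ | ⟨t, ht, h⟩
    · refine ⟨_, _, .left₁ (a + 1) (b + 1) (t + 1) _ (by omega), ?_⟩
      rw [pushX_eq_self (by omega), coin_succ_succ]
      exact (ih _ (by omega) _ _ _ _ rfl).1 h
    · refine ⟨_, _, .up₁ (a + 1) (b + 1) (t + 1) _ (by omega), ?_⟩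
      rw [pushY_eq_self (by omega), coin_succ_succ]
      exact (ih _ (by omega) _ _ _ _ rfl).1 h
    · refine ⟨_, _, .left₂ (c + 1) (d + 1) (t + 1) _ (by omega), ?_⟩
      rw [pushX_eq_self (by omega), coin_succ_succ]
      exact (ih _ (by omega) _ _ _ _ rfl).1 h
    · refine ⟨_, _, .up₂ (c + 1) (d + 1) (t + 1) _ (by omega), ?_⟩
      rw [pushY_eq_self (by omega), coin_succ_succ]
      exact (ih _ (by omega) _ _ _ _ rfl).1 h

/-- In the two-dimensional Silver Dollar game with pushing, a position `(w, x, y, z)`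
with both coins on the board is a P-position if and only if
`(w-1) ⊕ (x-1) ⊕ (y-1) ⊕ (z-1) = 0`, where `⊕` is the bitwise XOR (nim-sum). -/
theorem silverDollar_with_push_PPositions (w x y z : ℕ)
    (hw : 1 ≤ w) (hx : 1 ≤ x) (hy : 1 ≤ y) (hz : 1 ≤ z)
    (hne : (w, x) ≠ (y, z)) :
    PPosition PushMove (some (w, x), some (y, z)) ↔
      (w - 1) ^^^ (x - 1) ^^^ (y - 1) ^^^ (z - 1) = 0 := by
  obtain ⟨a, rfl⟩ := Nat.exists_eq_add_of_le' hw
  obtain ⟨b, rfl⟩ := Nat.exists_eq_add_of_le' hx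
  obtain ⟨c, rfl⟩ := Nat.exists_eq_add_of_le' hy
  obtain ⟨d, rfl⟩ := Nat.exists_eq_add_of_le' hz
  simp only [Nat.add_sub_cancel]
  obtain ⟨hP, hN⟩ := pPosition_and_nPosition _ a b c d rfl
  exact ⟨fun hp => by_contra fun h => hp.not_nPosition (hN h), hP⟩
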